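/- There exists a constant C < ∞, independent of n, such that for all n ≥ 2 and all 2 ≤ m ≤ n, |ϑ_n(m) − m · p^{(∞)}_{m/n}| ≤ C. Consequently, the expected number of leaves in the change-point preferential attachment tree of size m ≤ n satisfies sup_{0 ≤ t ≤ 1} |E[N̂_n(t)] − n t p_t^{(∞)}| ≤ C. -/

import Mathlib

open Set

/-- The weights of the leaf-count recursion for the change-point preferential attachment model:
`w_m = 1 − (1+α)/((2+α)m − 1)` for `m ≤ ⌈nγ⌉ − 1` and `w_m = 1 − (1+β)/((2+β)m − 1)` for
`m ≥ ⌈nγ⌉`. -/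
noncomputable def cpWeight (α β γ : ℝ) (n m : ℕ) : ℝ :=
  if m ≤ ⌈(n : ℝ) * γ⌉₊ - 1 then 1 - (1 + α) / ((2 + α) * (m : ℝ) - 1)
  else 1 - (1 + β) / ((2 + β) * (m : ℝ) - 1)

/-- The expected number of leaves `ϑ_n(m)` in the change-point preferential attachment tree of
size `m`: `ϑ_n(2) = 1` and `ϑ_n(m+1) = 1 + w_m ϑ_n(m)` for `m ≥ 2`. -/
noncomputable def cpTheta (α β γ : ℝ) (n : ℕ) : ℕ → ℝ
  | 0 => 0
  | 1 => 0
  | 2 => 1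
  | m + 3 => 1 + cpWeight α β γ n (m + 2) * cpTheta α β γ n (m + 2)

/-- The limiting leaf density `p_t^{(∞)}` of the change-point preferential attachment model. -/
noncomputable def leafDensity (α β γ : ℝ) (t : ℝ) : ℝ :=
  if t ≤ γ then (2 + α) / (3 + 2 * α)
  else ((2 + β) / (3 + 2 * β)) * (1 - (γ / t) ^ ((3 + 2 * β) / (2 + β)))
    + (γ / t) * ((2 + α) / (3 + 2 * α)) * (γ / t) ^ ((1 + β) / (2 + β))

lemma cp_u_bounds (β : ℝ) (hβ : 0 < β) (m : ℝ) (hm : 2 ≤ m) :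
    0 < (2 + β) * m - 1 ∧ 0 < (1 + β) / ((2 + β) * m - 1) ∧
      (1 + β) / ((2 + β) * m - 1) ≤ 1 := by
  have h : 0 < (2 + β) * m - 1 := by nlinarith
  refine ⟨h, by positivity, ?_⟩
  rw [div_le_one h]; nlinarith

lemma cp_step (u e D M : ℝ) (hu : 0 < u) (hu1 : u ≤ 1) (he : |e| ≤ M) (hD : |D| ≤ u * M) :
    |(1 - u) * e + D| ≤ M := by
  rw [abs_le] at *
  constructor <;> nlinarith

lemma cp_const (β : ℝ) (hβ : 0 < β) (m : ℝ) (hm : 2 ≤ m) :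
    1 - (2 + β) / (3 + 2 * β) - (2 + β) / (3 + 2 * β) * m * ((1 + β) / ((2 + β) * m - 1))
      = - ((1 + β) / ((2 + β) * m - 1)) * (1 / (3 + 2 * β)) := by
  have h := (cp_u_bounds β hβ m hm).1.ne'
  have h2 : 3 + 2 * β ≠ 0 := by positivity
  field_simp
  ring

lemma cp_rho (b : ℝ) (hb : 0 < b) (hb1 : b < 1) (m : ℝ) (hm : 2 ≤ m) :
    1 - b / m ≤ (m / (m + 1)) ^ b ∧ (m / (m + 1)) ^ b ≤ 1 - b / (m + 1) := by
  have hm0 : 0 < m := by linarith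
  constructor
  · have h1 : (1 + 1 / m) ^ b ≤ 1 + b * (1 / m) :=
      rpow_one_add_le_one_add_mul_self (by
        have : 0 < 1 / m := by positivity
        linarith) hb.le hb1.le
    have h2 : (m / (m + 1)) ^ b = ((1 + 1 / m) ^ b)⁻¹ := by
      rw [← Real.inv_rpow (by positivity)]
      congr 1
      field_simp
    rw [h2]
    have h3 : (1 + b * (1 / m))⁻¹ ≤ ((1 + 1 / m) ^ b)⁻¹ :=
      inv_anti₀ (by positivity) h1
    refine le_trans ?_ h3
    rw [← one_div, le_div_iff₀ (by positivity)]
    have : (1 - b / m) * (1 + b * (1 / m)) = 1 - (b / m) ^ 2 := by ring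
    rw [this]
    nlinarith [sq_nonneg (b / m)]
  · have h1 : (1 + (-(1 / (m + 1)))) ^ b ≤ 1 + b * (-(1 / (m + 1))) :=
      rpow_one_add_le_one_add_mul_self (by
        have : 1 / (m + 1) ≤ 1 := by
          rw [div_le_one (by positivity)]; linarith
        linarith) hb.le hb1.le
    have h2 : m / (m + 1) = 1 + (-(1 / (m + 1))) := by field_simp; ring
    rw [h2]
    refine h1.trans (le_of_eq ?_)
    ring

lemma cp_g (β : ℝ) (hβ : 0 < β) (x m : ℝ) (hm : 2 ≤ m) (hx : 0 < x) (hxm : x ≤ m) :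
    |x * (x / (m + 1)) ^ ((1 + β) / (2 + β))
      - (1 - (1 + β) / ((2 + β) * m - 1)) * (x * (x / m) ^ ((1 + β) / (2 + β)))|
      ≤ 2 * ((1 + β) / ((2 + β) * m - 1)) := by
  obtain ⟨hd, hu, hu1⟩ := cp_u_bounds β hβ m hm
  have hm0 : 0 < m := by linarith
  have hb : 0 < (1 + β) / (2 + β) := by positivity
  have hb1 : (1 + β) / (2 + β) < 1 := by rw [div_lt_one (by positivity)]; linarith
  obtain ⟨hl, hr⟩ := cp_rho _ hb hb1 m hm
  have e1 : x / (m + 1) = (x / m) * (m / (m + 1)) := by field_simp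
  rw [e1, Real.mul_rpow (by positivity) (by positivity)]
  have hG0 : 0 ≤ (x / m) ^ ((1 + β) / (2 + β)) := by positivity
  have hG1 : (x / m) ^ ((1 + β) / (2 + β)) ≤ 1 :=
    Real.rpow_le_one (by positivity) (by rw [div_le_one hm0]; exact hxm) hb.le
  have k1 : (1 + β) / (2 + β) / m ≤ (1 + β) / ((2 + β) * m - 1) := by
    rw [div_div]
    apply div_le_div_of_nonneg_left (by positivity) hd (by linarith)
  have k2 : m * ((1 + β) / ((2 + β) * m - 1) - (1 + β) / (2 + β) / (m + 1))
      ≤ 2 * ((1 + β) / ((2 + β) * m - 1)) := by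
    have : (1 + β) / (2 + β) / (m + 1) =
      (1 + β) / ((2 + β) * m - 1) * (((2 + β) * m - 1) / ((2 + β) * (m + 1))) := by
      field_simp
    rw [this]
    have h3 : m * (1 - ((2 + β) * m - 1) / ((2 + β) * (m + 1))) ≤ 2 := by
      have : m * (1 - ((2 + β) * m - 1) / ((2 + β) * (m + 1)))
        = m * (3 + β) / ((2 + β) * (m + 1)) := by field_simp; ring
      rw [this, div_le_iff₀ (by positivity)]
      nlinarith
    nlinarith
  set u := (1 + β) / ((2 + β) * m - 1)
  set b := (1 + β) / (2 + β)
  set G := (x / m) ^ b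
  set ρ := (m / (m + 1)) ^ b
  have e2 : x * (G * ρ) - (1 - u) * (x * G) = (x * G) * (ρ - 1 + u) := by ring
  have hρ : 0 ≤ ρ - 1 + u := by linarith
  have hxG : x * G ≤ m := by nlinarith
  have hxG0 : 0 ≤ x * G := by positivity
  rw [e2, abs_of_nonneg (by positivity)]
  calc (x * G) * (ρ - 1 + u) ≤ m * (ρ - 1 + u) := by gcongr
    _ ≤ m * (u - b / (m + 1)) := by gcongr; linarith
    _ ≤ _ := k2

lemma cpTheta_succ (α β γ : ℝ) (n m : ℕ) (hm : 2 ≤ m) :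
    cpTheta α β γ n (m + 1) = 1 + cpWeight α β γ n m * cpTheta α β γ n m := by
  obtain ⟨k, rfl⟩ := Nat.exists_eq_add_of_le hm
  rw [show 2 + k + 1 = k + 3 by ring, show 2 + k = k + 2 by ring]
  simp only [cpTheta]

lemma cp_q (β : ℝ) (hβ : 0 < β) :
    1 / 2 ≤ (2 + β) / (3 + 2 * β) ∧ (2 + β) / (3 + 2 * β) ≤ 1 := by
  constructor
  · rw [div_le_div_iff₀ (by positivity) (by positivity)]; linarith
  · rw [div_le_one (by positivity)]; linarith

lemma cp_phase1 (α β γ : ℝ) (hα : 0 < α) (n m : ℕ) (hm : 2 ≤ m)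
    (hmk : m ≤ ⌈(n : ℝ) * γ⌉₊) :
    |cpTheta α β γ n m - (2 + α) / (3 + 2 * α) * m| ≤ 1 := by
  induction m, hm using Nat.le_induction with
  | base =>
    obtain ⟨h1, h2⟩ := cp_q α hα
    simp only [cpTheta]
    rw [abs_le]; push_cast; constructor <;> linarith
  | succ m hm ih =>
    have ih := ih (by omega)
    have hm' : (2 : ℝ) ≤ m := by exact_mod_cast hm
    obtain ⟨hd, hu, hu1⟩ := cp_u_bounds α hα m hm'
    have hc := cp_const α hα m hm'
    rw [cpTheta_succ _ _ _ _ _ hm, cpWeight, if_pos (by omega)]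
    have h3 : 1 / (3 + 2 * α) ≤ 1 := by rw [div_le_one (by positivity)]; linarith
    have h30 : 0 < 1 / (3 + 2 * α) := by positivity
    push_cast
    set u := (1 + α) / ((2 + α) * (m : ℝ) - 1)
    have := cp_step u _ (-u * (1 / (3 + 2 * α))) 1 hu hu1 ih (by
      rw [abs_le]; constructor <;> nlinarith)
    convert this using 2
    linear_combination hc

lemma cp_phase2 (α β γ : ℝ) (hα : 0 < α) (hβ : 0 < β) (hγ : γ ∈ Set.Ioo (0 : ℝ) 1)
    (n : ℕ) (hn : 2 ≤ n) (m : ℕ) (hm : max 2 ⌈(n : ℝ) * γ⌉₊ ≤ m) :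
    |cpTheta α β γ n m - ((2 + β) / (3 + 2 * β) * m
      + ((2 + α) / (3 + 2 * α) - (2 + β) / (3 + 2 * β)) *
        (n * γ * (n * γ / m) ^ ((1 + β) / (2 + β))))| ≤ 4 := by
  have hn0 : (0 : ℝ) < n := by
    have : (2 : ℝ) ≤ n := by exact_mod_cast hn
    linarith
  have hx : 0 < (n : ℝ) * γ := mul_pos hn0 hγ.1
  obtain ⟨p1, p2⟩ := cp_q α hα
  obtain ⟨q1, q2⟩ := cp_q β hβ
  have hb : 0 < (1 + β) / (2 + β) := by positivity
  have hb1 : (1 + β) / (2 + β) < 1 := by rw [div_lt_one (by positivity)]; linarith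
  have hk0 : 0 < ⌈(n : ℝ) * γ⌉₊ := Nat.ceil_pos.mpr hx
  induction m, hm using Nat.le_induction with
  | base =>
    rcases le_total 2 ⌈(n : ℝ) * γ⌉₊ with h | h
    · rw [max_eq_right h]
      have h1 := cp_phase1 α β γ hα n _ h le_rfl
      have hk1 := Nat.le_ceil ((n : ℝ) * γ)
      have hk2 := Nat.ceil_lt_add_one hx.le
      set k : ℝ := (⌈(n : ℝ) * γ⌉₊ : ℝ)
      set x := (n : ℝ) * γ
      have hkp : 0 < k := by linarith
      have hxk : x / k ≤ 1 := by rw [div_le_one hkp]; exact hk1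
      have hG0 : x / k ≤ (x / k) ^ ((1 + β) / (2 + β)) := by
        conv_lhs => rw [← Real.rpow_one (x / k)]
        exact Real.rpow_le_rpow_of_exponent_ge (by positivity) hxk hb1.le
      have hG1 : (x / k) ^ ((1 + β) / (2 + β)) ≤ 1 :=
        Real.rpow_le_one (by positivity) hxk hb.le
      set G := (x / k) ^ ((1 + β) / (2 + β))
      have h5 : x * G ≤ k := by nlinarith
      have h6 : k - 2 ≤ x * G := by
        have : k - 2 ≤ x * (x / k) := by
          rw [← mul_div_assoc, le_div_iff₀ hkp]; nlinarith
        nlinarith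
      have hpq : |(2 + α) / (3 + 2 * α) - (2 + β) / (3 + 2 * β)| ≤ 1 := by
        rw [abs_le]; constructor <;> linarith
      have h7 : |((2 + α) / (3 + 2 * α) - (2 + β) / (3 + 2 * β)) * (k - x * G)| ≤ 1 * 2 := by
        rw [abs_mul]
        refine mul_le_mul hpq ?_ (abs_nonneg _) (by norm_num)
        rw [abs_le]; constructor <;> linarith
      have h8 := abs_add_le _ _ |>.trans (add_le_add h1 h7)
      refine le_trans (le_of_eq ?_) (h8.trans (by norm_num))
      congr 1
      ring
    · rw [max_eq_left h]
      have hk1 := Nat.le_ceil ((n : ℝ) * γ)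
      have hk2 : (⌈(n : ℝ) * γ⌉₊ : ℝ) ≤ 2 := by exact_mod_cast h
      simp only [cpTheta]
      push_cast
      set x := (n : ℝ) * γ
      have hG0 : 0 ≤ (x / 2) ^ ((1 + β) / (2 + β)) := by positivity
      have hG1 : (x / 2) ^ ((1 + β) / (2 + β)) ≤ 1 :=
        Real.rpow_le_one (by positivity) (by linarith) hb.le
      set G := (x / 2) ^ ((1 + β) / (2 + β))
      have h5 : x * G ≤ 2 := by nlinarith
      have h6 : 0 ≤ x * G := by positivity
      rw [abs_le]; constructor <;> nlinarith
  | succ m hm ih =>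
    have hm2 : 2 ≤ m := le_trans (le_max_left _ _) hm
    have hmk : ⌈(n : ℝ) * γ⌉₊ ≤ m := le_trans (le_max_right _ _) hm
    have hm' : (2 : ℝ) ≤ m := by exact_mod_cast hm2
    have hxm : (n : ℝ) * γ ≤ m := Nat.ceil_le.mp hmk
    obtain ⟨hd, hu, hu1⟩ := cp_u_bounds β hβ m hm'
    have hc := cp_const β hβ m hm'
    have hg := cp_g β hβ _ m hm' hx hxm
    rw [cpTheta_succ _ _ _ _ _ hm2, cpWeight, if_neg (by omega)]
    have h3 : 1 / (3 + 2 * β) ≤ 1 := by rw [div_le_one (by positivity)]; linarith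
    have h30 : 0 < 1 / (3 + 2 * β) := by positivity
    push_cast
    have hpq : |(2 + α) / (3 + 2 * α) - (2 + β) / (3 + 2 * β)| ≤ 1 := by
      rw [abs_le]; constructor <;> linarith
    set u := (1 + β) / ((2 + β) * (m : ℝ) - 1)
    have h7 := (abs_mul _ _).le.trans (mul_le_mul hpq hg (abs_nonneg _) (by norm_num))
    have h8 : |-u * (1 / (3 + 2 * β))| ≤ u := by
      rw [abs_le]; constructor <;> nlinarith
    have := cp_step u _ _ 4 hu hu1 ih ((abs_sub _ _).trans ((add_le_add h8 h7).trans (by linarith)))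
    convert this using 2
    linear_combination hc

/-- Fix `α, β > 0` and `γ ∈ (0,1)`. There exists a constant `C < ∞`,
independent of `n`, such that for all `n ≥ 2` and all `2 ≤ m ≤ n`,
`|ϑ_n(m) − m · p^{(∞)}_{m/n}| ≤ C`; i.e. the expected number of leaves in the change-point
preferential attachment tree of size `m ≤ n` is within a uniform constant of `m p^{(∞)}_{m/n}`. -/
theorem stmt_17 (α β γ : ℝ) (hα : 0 < α) (hβ : 0 < β) (hγ : γ ∈ Set.Ioo (0 : ℝ) 1) :
    ∃ C : ℝ, 0 < C ∧ ∀ n : ℕ, 2 ≤ n → ∀ m : ℕ, 2 ≤ m → m ≤ n →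
      |cpTheta α β γ n m - (m : ℝ) * leafDensity α β γ ((m : ℝ) / n)| ≤ C := by
  refine ⟨4, by norm_num, ?_⟩
  intro n hn m hm hmn
  have hn0 : (0 : ℝ) < n := by
    have : (2 : ℝ) ≤ n := by exact_mod_cast hn
    linarith
  have hm0 : (0 : ℝ) < m := by
    have : (2 : ℝ) ≤ m := by exact_mod_cast hm
    linarith
  have hγ0 := hγ.1
  unfold leafDensity
  split_ifs with h
  · rw [div_le_iff₀ hn0] at h
    have hk : m ≤ ⌈(n : ℝ) * γ⌉₊ := by
      have := Nat.le_ceil ((n : ℝ) * γ)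
      have h2 : (m : ℝ) ≤ (⌈(n : ℝ) * γ⌉₊ : ℝ) := by linarith
      exact_mod_cast h2
    have := cp_phase1 α β γ hα n m hm hk
    rw [mul_comm (m : ℝ)]
    linarith
  · rw [not_le, lt_div_iff₀ hn0] at h
    have hk : ⌈(n : ℝ) * γ⌉₊ ≤ m := Nat.ceil_le.mpr (by linarith)
    have := cp_phase2 α β γ hα hβ hγ n hn m (max_le hm hk)
    refine le_trans (le_of_eq ?_) this
    have e1 : γ / ((m : ℝ) / n) = n * γ / m := by field_simp
    have e2 : (3 + 2 * β) / (2 + β) = 1 + (1 + β) / (2 + β) := by field_simp; ring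
    have hpos : 0 < (n : ℝ) * γ / m := by positivity
    rw [e1, e2, Real.rpow_add hpos, Real.rpow_one]
    congr 2
    field_simp
    ring
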